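/- Let 0 < α < 1 and let γ ∈ C([a,b];ℝ). Suppose that ∫_a^b γ(t)·(d/dt)(C_aD_t^α[h])(t) dt = 0 for every h ∈ C¹([a,b];ℝ) such that t ↦ (d/dt)(C_aD_t^α[h])(t) is continuous on [a,b] and the boundary conditions h(a) = 0, aI_t^{1−α}[h](b) = 0, C_aD_t^α[h](a) = 0, and C_tD_b^α[h](b) = 0 are fulfilled. Then there exist real constants c₀, c₁ such that γ(t) = c₀ + c₁t for all t ∈ [a,b]. -/

import Mathlib

open MeasureTheory Set ENNReal

/-- The left Riemann–Liouville fractional integral of order `β`: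
`aI_t^β[f](t) = (1/Γ(β)) ∫_a^t (t-τ)^(β-1) f(τ) dτ`. -/
noncomputable def leftRL (a β : ℝ) (f : ℝ → ℝ) (t : ℝ) : ℝ :=
  (1 / Real.Gamma β) * ∫ τ in a..t, (t - τ) ^ (β - 1) * f τ

/-- The right Riemann–Liouville fractional integral of order `β`:
`tI_b^β[f](t) = (1/Γ(β)) ∫_t^b (τ-t)^(β-1) f(τ) dτ`. -/
noncomputable def rightRL (b β : ℝ) (f : ℝ → ℝ) (t : ℝ) : ℝ :=
  (1 / Real.Gamma β) * ∫ τ in t..b, (τ - t) ^ (β - 1) * f τ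

/-- The left Caputo fractional derivative of order `α` (of a function on `[a,b]`):
`C_aD_t^α[f] = aI_t^{1-α}[f']`. -/
noncomputable def capL (a b α : ℝ) (f : ℝ → ℝ) : ℝ → ℝ :=
  leftRL a (1 - α) (derivWithin f (Icc a b))

/-- The right Caputo fractional derivative of order `α` (of a function on `[a,b]`):
`C_tD_b^α[f] = −tI_b^{1-α}[f']`. -/
noncomputable def capR (a b α : ℝ) (f : ℝ → ℝ) (t : ℝ) : ℝ :=
  -(rightRL b (1 - α) (derivWithin f (Icc a b)) t)

theorem integral_rpow_mul_sub_rpow {p q c : ℝ} (hp : 0 < p) (hq : 0 < q) (hc : 0 < c) :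
    ∫ x in 0..c, x ^ (p - 1) * (c - x) ^ (q - 1) =
      c ^ (p + q - 1) * (Real.Gamma p * Real.Gamma q / Real.Gamma (p + q)) := by
  have h := Complex.betaIntegral_scaled (p : ℂ) (q : ℂ) hc
  rw [Complex.betaIntegral_eq_Gamma_mul_div _ _ (by simpa) (by simpa)] at h
  apply Complex.ofReal_injective
  rw [← intervalIntegral.integral_ofReal]
  push_cast [Complex.Gamma_ofReal, Complex.ofReal_cpow hc.le]
  rw [← Complex.Gamma_ofReal, ← Complex.Gamma_ofReal, ← Complex.Gamma_ofReal]
  push_cast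
  rw [← h]
  refine intervalIntegral.integral_congr fun x hx => ?_
  rw [uIcc_of_le hc.le] at hx
  rw [Complex.ofReal_cpow hx.1, Complex.ofReal_cpow (sub_nonneg.2 hx.2)]
  push_cast
  rfl

theorem integral_sub_rpow_mul_sub_rpow {p q s t : ℝ} (hp : 0 < p) (hq : 0 < q) (hst : s < t) :
    ∫ τ in s..t, (t - τ) ^ (p - 1) * (τ - s) ^ (q - 1) =
      (t - s) ^ (p + q - 1) * (Real.Gamma p * Real.Gamma q / Real.Gamma (p + q)) := by
  rw [← integral_rpow_mul_sub_rpow hp hq (sub_pos.2 hst)]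
  have h := intervalIntegral.integral_comp_sub_left (a := s) (b := t)
    (fun x => x ^ (p - 1) * (t - s - x) ^ (q - 1)) t
  rw [sub_self] at h
  rw [← h]
  refine intervalIntegral.integral_congr fun x _ => ?_
  congr 2
  ring

theorem intervalIntegrable_sub_rpow {β : ℝ} (hβ : 0 < β) (c u v : ℝ) :
    IntervalIntegrable (fun τ => (c - τ) ^ (β - 1)) volume u v := by
  simpa using (intervalIntegral.intervalIntegrable_rpow' (a := c - u) (b := c - v)
    (show -1 < β - 1 by linarith)).comp_sub_left c

theorem exists_continuous_eqOn_leftRL (a : ℝ) {β : ℝ} (hβ : 0 < β) {f : ℝ → ℝ}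
    (hf : Continuous f) :
    ∃ g : ℝ → ℝ, Continuous g ∧ EqOn (leftRL a β f) g (Ici a) := by
  refine ⟨fun t => 1 / Real.Gamma β * ((t - a) ^ β *
    ∫ x in (0 : ℝ)..1, (1 - x) ^ (β - 1) * f (a + x * (t - a))), ?_, ?_⟩
  · have hint : Continuous fun t => ∫ x in (0 : ℝ)..1, (1 - x) ^ (β - 1) * f (a + x * (t - a)) := by
      rw [continuous_iff_continuousAt]
      intro t₀
      obtain ⟨M, hM⟩ := (isCompact_Icc.prod (isCompact_Icc (a := t₀ - 1) (b := t₀ + 1))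
        |>.exists_bound_of_continuousOn (s := Icc (0 : ℝ) 1 ×ˢ Icc (t₀ - 1) (t₀ + 1))
        (f := fun z : ℝ × ℝ => f (a + z.1 * (z.2 - a))) (by fun_prop))
      have hk := intervalIntegrable_sub_rpow hβ 1 0 1
      refine intervalIntegral.continuousAt_of_dominated_interval
        (bound := fun x => ‖(1 - x) ^ (β - 1)‖ * M) ?_ ?_ (hk.norm.mul_const M) ?_
      · refine Filter.Eventually.of_forall fun t => ?_
        exact (hk.mul_continuousOn (g := fun x => f (a + x * (t - a)))
          (by fun_prop)).aestronglyMeasurable_restrict_uIoc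
      · filter_upwards [Icc_mem_nhds (show t₀ - 1 < t₀ by linarith)
          (show t₀ < t₀ + 1 by linarith)] with t ht
        refine Filter.Eventually.of_forall fun x hx => ?_
        rw [uIoc_of_le zero_le_one] at hx
        rw [norm_mul]
        exact mul_le_mul_of_nonneg_left (hM (x, t) ⟨Ioc_subset_Icc_self hx, ht⟩) (norm_nonneg _)
      · refine Filter.Eventually.of_forall fun x _ => ?_
        fun_prop
    exact continuous_const.mul
      (((continuous_id.sub continuous_const).rpow_const fun _ => Or.inr hβ.le).mul hint)
  · intro t ht
    simp only [leftRL]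
    congr 1
    rcases (mem_Ici.1 ht).eq_or_lt with rfl | hat
    · simp [Real.zero_rpow hβ.ne']
    · have hc : 0 < t - a := sub_pos.2 hat
      have h := intervalIntegral.smul_integral_comp_mul_add (a := 0) (b := 1)
        (fun τ => (t - τ) ^ (β - 1) * f τ) (t - a) a
      simp only [mul_zero, zero_add, mul_one, sub_add_cancel, smul_eq_mul] at h
      rw [← h, ← intervalIntegral.integral_const_mul, ← intervalIntegral.integral_const_mul]
      refine intervalIntegral.integral_congr fun x hx => ?_
      rw [uIcc_of_le zero_le_one] at hx
      have e : t - ((t - a) * x + a) = (t - a) * (1 - x) := by ring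
      rw [e, Real.mul_rpow hc.le (sub_nonneg.2 hx.2), Real.rpow_sub_one hc.ne',
        show (t - a) * x + a = a + x * (t - a) by ring]
      field_simp

theorem leftRL_congr {a β t : ℝ} {f g : ℝ → ℝ} (hat : a ≤ t) (h : EqOn f g (Icc a t)) :
    leftRL a β f t = leftRL a β g t := by
  simp only [leftRL]
  congr 1
  refine intervalIntegral.integral_congr fun x hx => ?_
  rw [uIcc_of_le hat] at hx
  simp only [h hx]

theorem leftRL_one (a : ℝ) (f : ℝ → ℝ) (t : ℝ) : leftRL a 1 f t = ∫ τ in a..t, f τ := by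
  simp [leftRL]

theorem leftRL_leftRL {a p q t : ℝ} (hp : 0 < p) (hq : 0 < q) {f : ℝ → ℝ} (hf : Continuous f)
    (hat : a ≤ t) : leftRL a p (leftRL a q f) t = leftRL a (p + q) f t := by
  have hΓp := (Real.Gamma_pos_of_pos hp).ne'
  have hΓq := (Real.Gamma_pos_of_pos hq).ne'
  have hΓ := (Real.Gamma_pos_of_pos (add_pos hp hq)).ne'
  set μ : Measure ℝ := volume.restrict (Ioc a t) with hμ
  set K : ℝ × ℝ → ℝ := {x : ℝ × ℝ | x.2 ≤ x.1}.indicator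
    fun x => (t - x.1) ^ (p - 1) * ((x.1 - x.2) ^ (q - 1) * f x.2) with hK
  have hKm : Measurable K :=
    Measurable.indicator (by fun_prop) (measurableSet_le measurable_snd measurable_fst)
  have hsec : ∀ τ, (fun s => K (τ, s)) = (Iic τ).indicator
      fun s => (t - τ) ^ (p - 1) * ((τ - s) ^ (q - 1) * f s) := fun τ => rfl
  have hsec' : ∀ s, (fun τ => K (τ, s)) = (Ici s).indicator
      fun τ => (t - τ) ^ (p - 1) * ((τ - s) ^ (q - 1) * f s) := fun τ => rfl
  have hI : ∀ τ ∈ Ioc a t, Ioc a t ∩ Iic τ = Ioc a τ := fun τ hτ => by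
    rw [Ioc_inter_Iic, min_eq_right hτ.2]
  have hfst : ∀ τ ∈ Ioc a t, ∫ s, K (τ, s) ∂μ =
      (t - τ) ^ (p - 1) * ∫ s in a..τ, (τ - s) ^ (q - 1) * f s := fun τ hτ => by
    rw [hsec, hμ, setIntegral_indicator measurableSet_Iic, hI τ hτ, integral_const_mul,
      intervalIntegral.integral_of_le hτ.1.le]
  have hfst_norm : ∀ τ ∈ Ioc a t, ∫ s, ‖K (τ, s)‖ ∂μ =
      (t - τ) ^ (p - 1) * (Real.Gamma q * leftRL a q (fun s => |f s|) τ) := fun τ hτ => by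
    have : (fun s => ‖K (τ, s)‖) = (Iic τ).indicator
        fun s => (t - τ) ^ (p - 1) * ((τ - s) ^ (q - 1) * |f s|) := by
      ext s
      rw [congrFun (hsec τ) s, norm_indicator_eq_indicator_norm]
      refine congrFun (indicator_congr fun s hs => ?_) s
      rw [norm_mul, norm_mul, Real.norm_of_nonneg (Real.rpow_nonneg (sub_nonneg.2 hτ.2) _),
        Real.norm_of_nonneg (Real.rpow_nonneg (sub_nonneg.2 hs) _), Real.norm_eq_abs]
    rw [this, hμ, setIntegral_indicator measurableSet_Iic, hI τ hτ, integral_const_mul, leftRL,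
      intervalIntegral.integral_of_le hτ.1.le]
    field_simp
  have hint : Integrable K (μ.prod μ) := by
    rw [integrable_prod_iff hKm.aestronglyMeasurable]
    constructor
    · refine (ae_restrict_iff' measurableSet_Ioc).2 (Filter.Eventually.of_forall fun τ hτ => ?_)
      rw [hsec, integrable_indicator_iff measurableSet_Iic, IntegrableOn, hμ,
        Measure.restrict_restrict measurableSet_Iic, inter_comm, hI τ hτ]
      refine Integrable.const_mul ?_ _
      exact (((intervalIntegrable_sub_rpow hq τ a τ).mul_continuousOn
        hf.continuousOn).1)
    · obtain ⟨g, hg, hge⟩ := exists_continuous_eqOn_leftRL a hq hf.abs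
      have h1 : IntegrableOn (fun τ => (t - τ) ^ (p - 1) * (Real.Gamma q * g τ)) (Ioc a t) :=
        ((intervalIntegrable_sub_rpow hp t a t).mul_continuousOn
          (by fun_prop : ContinuousOn (fun τ => Real.Gamma q * g τ) _)).1
      refine h1.congr_fun (fun τ hτ => ?_) measurableSet_Ioc
      simp only
      rw [hfst_norm τ hτ, hge hτ.1.le]
  have hsnd : ∀ s ∈ Ioo a t, ∫ τ, K (τ, s) ∂μ =
      Real.Gamma p * Real.Gamma q / Real.Gamma (p + q) * ((t - s) ^ (p + q - 1) * f s) :=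
    fun s hs => by
    have hIs : Ioc a t ∩ Ici s = Icc s t := by
      ext x
      simp only [mem_inter_iff, mem_Ioc, mem_Ici, mem_Icc]
      exact ⟨fun h => ⟨h.2, h.1.2⟩, fun h => ⟨⟨hs.1.trans_le h.1, h.2⟩, h.1⟩⟩
    rw [hsec', hμ, setIntegral_indicator measurableSet_Ici, hIs, integral_Icc_eq_integral_Ioc,
      ← intervalIntegral.integral_of_le hs.2.le]
    simp_rw [← mul_assoc]
    rw [intervalIntegral.integral_mul_const, integral_sub_rpow_mul_sub_rpow hp hq hs.2]
    ring
  have hswap := integral_integral_swap (f := fun τ s => K (τ, s)) hint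
  have hL : ∫ τ, ∫ s, K (τ, s) ∂μ ∂μ =
      ∫ τ in a..t, (t - τ) ^ (p - 1) * ∫ s in a..τ, (τ - s) ^ (q - 1) * f s := by
    rw [intervalIntegral.integral_of_le hat]
    exact setIntegral_congr_fun measurableSet_Ioc hfst
  have hR : ∫ s, ∫ τ, K (τ, s) ∂μ ∂μ = Real.Gamma p * Real.Gamma q / Real.Gamma (p + q) *
      ∫ s in a..t, (t - s) ^ (p + q - 1) * f s := by
    rw [← intervalIntegral.integral_const_mul, intervalIntegral.integral_of_le hat,
      integral_Ioc_eq_integral_Ioo, integral_Ioc_eq_integral_Ioo]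
    exact setIntegral_congr_fun measurableSet_Ioo hsnd
  rw [hL, hR] at hswap
  simp only [leftRL]
  simp_rw [mul_left_comm _ (1 / Real.Gamma q)]
  rw [intervalIntegral.integral_const_mul, hswap]
  field_simp

/-- Every continuous `φ` orthogonal to `t ↦ b - t` on `[a, b]` is, on `[a, b]`, the derivative of the
Caputo derivative of an admissible test function, namely of the fractional integral of `φ` of order
`1 + α`. -/
theorem integral_mul_eq_zero_of_orthogonal {a b α : ℝ} (hab : a < b) (hα0 : 0 < α) (hα1 : α < 1)
    {γ : ℝ → ℝ}
    (hyp : ∀ h : ℝ → ℝ,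
      ContDiffOn ℝ 1 h (Icc a b) →
      ContinuousOn (derivWithin (capL a b α h) (Icc a b)) (Icc a b) →
      h a = 0 → leftRL a (1 - α) h b = 0 →
      capL a b α h a = 0 → capR a b α h b = 0 →
      (∫ t in a..b, γ t * derivWithin (capL a b α h) (Icc a b) t) = 0)
    {φ : ℝ → ℝ} (hφ : Continuous φ) (horth : ∫ t in a..b, (b - t) * φ t = 0) :
    ∫ t in a..b, γ t * φ t = 0 := by
  have hβ : 0 < 1 - α := sub_pos.2 hα1
  have hU : UniqueDiffOn ℝ (Icc a b) := uniqueDiffOn_Icc hab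
  obtain ⟨ψ, hψ, hψe⟩ := exists_continuous_eqOn_leftRL a hα0 hφ
  set h : ℝ → ℝ := fun t => ∫ τ in a..t, ψ τ with hh
  have hderiv : ∀ t, HasDerivAt h (ψ t) t := fun t => hψ.integral_hasStrictDerivAt a t |>.hasDerivAt
  have hdW : EqOn (derivWithin h (Icc a b)) ψ (Icc a b) := fun t ht =>
    (hderiv t).hasDerivWithinAt.derivWithin (hU t ht)
  have hcap : EqOn (capL a b α h) (fun t => ∫ τ in a..t, φ τ) (Icc a b) := fun t ht => by
    rw [capL, leftRL_congr (g := leftRL a α φ) ht.1, leftRL_leftRL hβ hα0 hφ ht.1,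
      sub_add_cancel, leftRL_one]
    intro s hs
    rw [hdW ⟨hs.1, hs.2.trans ht.2⟩, hψe hs.1]
  have hcap_deriv : EqOn (derivWithin (capL a b α h) (Icc a b)) φ (Icc a b) := fun t ht => by
    rw [derivWithin_congr hcap (hcap ht)]
    exact (hφ.integral_hasStrictDerivAt a t).hasDerivAt.hasDerivWithinAt.derivWithin (hU t ht)
  have hh_eq : EqOn h (leftRL a (1 + α) φ) (Icc a b) := fun t ht => by
    rw [← leftRL_leftRL one_pos hα0 hφ ht.1, leftRL_one]
    refine intervalIntegral.integral_congr fun s hs => ?_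
    rw [uIcc_of_le ht.1] at hs
    exact (hψe hs.1).symm
  have key := hyp h ?_ (hφ.continuousOn.congr hcap_deriv) (by simp [hh]) ?_
    (by simp [capL, leftRL]) (by simp [capR, rightRL])
  · rw [← key]
    refine intervalIntegral.integral_congr fun t ht => ?_
    rw [uIcc_of_le hab.le] at ht
    simp only [hcap_deriv ht]
  · refine ContDiff.contDiffOn (contDiff_one_iff_deriv.2 ⟨fun t => (hderiv t).differentiableAt, ?_⟩)
    rwa [funext fun t => (hderiv t).deriv]
  · rw [leftRL_congr hab.le hh_eq, leftRL_leftRL hβ (by linarith) hφ hab.le,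
      show 1 - α + (1 + α) = 1 + 1 by ring, leftRL]
    simp [horth]

/-- Lemma `lem:A`: if `∫_a^b γ·(d/dt)(C_aD_t^α[h]) dt = 0` for every `h ∈ C¹([a,b];ℝ)`
with `d/dt(C_aD_t^α[h])` continuous and the boundary conditions `h(a) = 0`,
`aI^{1-α}[h](b) = 0`, `C_aD^α[h](a) = 0`, `C_tD_b^α[h](b) = 0`, then
`γ(t) = c₀ + c₁·t` for some real constants `c₀, c₁`. -/
theorem statement16 (a b α : ℝ) (hab : a < b) (hα0 : 0 < α) (hα1 : α < 1)
    (γ : ℝ → ℝ) (hγ : ContinuousOn γ (Icc a b))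
    (hyp : ∀ h : ℝ → ℝ,
      ContDiffOn ℝ 1 h (Icc a b) →
      ContinuousOn (derivWithin (capL a b α h) (Icc a b)) (Icc a b) →
      h a = 0 → leftRL a (1 - α) h b = 0 →
      capL a b α h a = 0 → capR a b α h b = 0 →
      (∫ t in a..b, γ t * derivWithin (capL a b α h) (Icc a b) t) = 0) :
    ∃ c0 c1 : ℝ, ∀ t ∈ Icc a b, γ t = c0 + c1 * t := by
  obtain ⟨γ', hγ', hγe⟩ : ∃ γ' : ℝ → ℝ, Continuous γ' ∧ EqOn γ γ' (Icc a b) :=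
    ⟨IccExtend hab.le ((Icc a b).domRestrict γ), hγ.domRestrict.Icc_extend', fun t ht => by
      rw [IccExtend_of_mem _ _ ht, domRestrict_apply]⟩
  have hpos : 0 < ∫ t in a..b, (b - t) ^ 2 :=
    intervalIntegral.intervalIntegral_pos_of_pos_on
      ((by fun_prop : Continuous fun t : ℝ => (b - t) ^ 2).intervalIntegrable a b)
      (fun t ht => pow_pos (sub_pos.2 ht.2) 2) hab
  set c := (∫ t in a..b, (b - t) * γ' t) / ∫ t in a..b, (b - t) ^ 2 with hc
  set φ : ℝ → ℝ := fun t => γ' t - c * (b - t) with hφ_def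
  have hφ : Continuous φ := by fun_prop
  have horth : ∫ t in a..b, (b - t) * φ t = 0 := by
    have e : ∀ t, (b - t) * φ t = (b - t) * γ' t - c * (b - t) ^ 2 := fun t => by
      simp only [hφ_def]; ring
    simp_rw [e]
    rw [intervalIntegral.integral_sub (Continuous.intervalIntegrable (by fun_prop) _ _)
      (Continuous.intervalIntegrable (by fun_prop) _ _), intervalIntegral.integral_const_mul, hc,
      div_mul_cancel₀ _ hpos.ne', sub_self]
  have hγφ := integral_mul_eq_zero_of_orthogonal hab hα0 hα1 hyp hφ horth
  have hsq : ∫ t in a..b, φ t ^ 2 = 0 := by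
    have e : ∀ t, φ t ^ 2 = γ' t * φ t - c * ((b - t) * φ t) := fun t => by
      simp only [hφ_def]; ring
    simp_rw [e]
    rw [intervalIntegral.integral_sub (Continuous.intervalIntegrable (by fun_prop) _ _)
      (Continuous.intervalIntegrable (by fun_prop) _ _), intervalIntegral.integral_const_mul,
      horth, mul_zero, sub_zero, ← hγφ]
    refine intervalIntegral.integral_congr fun t ht => ?_
    rw [uIcc_of_le hab.le] at ht
    simp only [hγe ht]
  have hzero : ∀ t ∈ Icc a b, φ t = 0 := by
    by_contra! ⟨t, ht, hne⟩
    exact (intervalIntegral.integral_pos hab (hφ.pow 2).continuousOn (fun _ _ => sq_nonneg _)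
      ⟨t, ht, sq_pos_of_ne_zero hne⟩).ne' hsq
  refine ⟨c * b, -c, fun t ht => ?_⟩
  have := hzero t ht
  simp only [hφ_def] at this
  rw [hγe ht]
  linarith
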